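/- Let (W, S) be a Coxeter system with S = {a, b, b′}, m_{ab} ≥ 3, m_{ab′} ≥ 3, and G = ⟨a,b′⟩⟨a,b⟩ ⊆ W. If m_{bb′} > 2 or m_{ab} = ∞ or m_{ab′} = ∞, then G contains no full element. If m_{bb′} = 2 and m_{ab}, m_{ab′} < ∞, then G contains exactly two full elements, namely Γ = ⟨m_{ab′}−1,a,b′][b,a,m_{ab}−1⟩ and Γ′ = ⟨m_{ab′}−1,a,b′]·a·[b,a,m_{ab}−1⟩. -/

import Mathlib

open CoxeterSystem Polynomial

section CoxPre

variable {B : Type*} {W : Type*} [Group W] {M : CoxeterMatrix B}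

/-- The alternating word of length `n` starting with the letter `i`
(and then alternating between `i` and `j`). -/
def altW (i j : B) : ℕ → List B
  | 0 => []
  | n + 1 => i :: altW j i n

variable (cs : CoxeterSystem M W)

/-- The Bruhat order on a Coxeter group: the reflexive-transitive closure of the
relation `u → u * t` (`t` a reflection) when the length goes up. -/
def bruhatLE : W → W → Prop :=
  Relation.ReflTransGen
    (fun u v => ∃ t, cs.IsReflection t ∧ v = u * t ∧ cs.length u < cs.length v)

/-- The covering relation of the Bruhat order. -/
def bCov (u v : W) : Prop :=
  bruhatLE cs u v ∧ u ≠ v ∧ ∀ z, bruhatLE cs u z → bruhatLE cs z v → z = u ∨ z = v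

/-- The set of coatoms of `v` in the Bruhat order. -/
def bCoat (v : W) : Set W := {x | bCov cs x v}

/-- A partial special matching of `W` equipped with the Bruhat order: a Bruhat order
ideal `dom` together with an involution of it such that `u ⋖ φ u` or `φ u ⋖ u` for all
`u ∈ dom`, satisfying the coatom condition. -/
structure BSM where
  dom : Set W
  toFun : W → W
  ideal : ∀ ⦃x y : W⦄, y ∈ dom → bruhatLE cs x y → x ∈ dom
  maps : ∀ x ∈ dom, toFun x ∈ dom
  invol : ∀ x ∈ dom, toFun (toFun x) = x
  cov : ∀ x ∈ dom, bCov cs (toFun x) x ∨ bCov cs x (toFun x)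
  coatom : ∀ u ∈ dom, bCov cs u (toFun u) →
    bCoat cs (toFun u) =
      {u} ∪ {w | ∃ v, bCov cs v u ∧ bCov cs v (toFun v) ∧ w = toFun v}

/-- The standard dihedral subgroup `⟨s,t⟩` of `W`, as a set. -/
def dihedral (s t : B) : Set W :=
  (Subgroup.closure {cs.simple s, cs.simple t} : Subgroup W)

/-- `w` is full with respect to `J ⊆ S`: for all distinct `i, j ∈ J`, `m i j < ∞` and the
longest element of `⟨i,j⟩` is `≤ w` in Bruhat order. -/
def IsFullWrt (J : Set B) (w : W) : Prop :=
  ∀ i ∈ J, ∀ j ∈ J, i ≠ j →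
    M i j ≠ 0 ∧ bruhatLE cs (cs.wordProd (altW i j (M i j))) w

/-- The standard axioms characterizing the `R`-polynomials of the Hecke algebra of `W`. -/
def RAxioms (R : W → W → Polynomial ℤ) : Prop :=
  (∀ u, R u u = 1) ∧
  (∀ u v, ¬ bruhatLE cs u v → R u v = 0) ∧
  (∀ (i : B) (x y : W),
      cs.length (cs.simple i * x) = cs.length x + 1 →
      cs.length (cs.simple i * y) = cs.length y + 1 →
      R (cs.simple i * x) (cs.simple i * y) = R x y ∧
      R x (cs.simple i * y) = (X - 1) * R x y + X * R (cs.simple i * x) y) ∧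
  (∀ (i : B) (x y : W),
      cs.length (x * cs.simple i) = cs.length x + 1 →
      cs.length (y * cs.simple i) = cs.length y + 1 →
      R (x * cs.simple i) (y * cs.simple i) = R x y ∧
      R x (y * cs.simple i) = (X - 1) * R x y + X * R (x * cs.simple i) y)

variable {cs}

/-- `ψ` extends the partial special matching `φ`. -/
def BExtends (ψ φ : BSM cs) : Prop :=
  φ.dom ⊆ ψ.dom ∧ ∀ x ∈ φ.dom, ψ.toFun x = φ.toFun x

/-- `φ` is a maximal partial special matching. -/
def BMax (φ : BSM cs) : Prop := ∀ ψ : BSM cs, BExtends ψ φ → ψ.dom = φ.dom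

/-- `φ` is `g`-regular on the left: its domain is stable under left multiplication by `g`
and `φ` commutes with left multiplication by `g`. -/
def LeftReg (φ : BSM cs) (g : W) : Prop :=
  (∀ x ∈ φ.dom, g * x ∈ φ.dom) ∧ ∀ x ∈ φ.dom, φ.toFun (g * x) = g * φ.toFun x

/-- `φ` is `g`-regular on the right. -/
def RightReg (φ : BSM cs) (g : W) : Prop :=
  (∀ x ∈ φ.dom, x * g ∈ φ.dom) ∧ ∀ x ∈ φ.dom, φ.toFun (x * g) = φ.toFun x * g

end CoxPre

section GeometricRepresentation

open Module

variable {B : Type*} (M : CoxeterMatrix B)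

/-- The simple root indexed by `i`, in the geometric representation. -/
noncomputable def geomRoot (i : B) : B →₀ ℝ := Finsupp.single i 1

/-- The simple coroot indexed by `i`, in the geometric representation. -/
noncomputable def geomCoroot (i : B) : Dual ℝ (B →₀ ℝ) :=
  Finsupp.linearCombination ℝ fun j => -2 * Real.cos (Real.pi / M i j)

theorem geomCoroot_root (i j : B) :
    geomCoroot M i (geomRoot j) = -2 * Real.cos (Real.pi / M i j) := by
  simp [geomCoroot, geomRoot]

theorem geomCoroot_root_self (i : B) : geomCoroot M i (geomRoot i) = 2 := by
  simp [geomCoroot_root]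

/-- The simple reflection indexed by `i`, in the geometric representation. -/
noncomputable def geomReflection (i : B) : (B →₀ ℝ) ≃ₗ[ℝ] (B →₀ ℝ) :=
  reflection (geomCoroot_root_self M i)

theorem chebyshevS_two_mul_cos (θ : ℝ) (n : ℤ) :
    (Polynomial.Chebyshev.S ℝ n).eval (2 * Real.cos θ) * Real.sin θ =
      Real.sin ((n + 1) * θ) := by
  rw [← Polynomial.Chebyshev.U_real_cos, ← Polynomial.Chebyshev.S_comp_two_mul_X]
  simp

theorem geomCoroot_mul_sub_two (i j : B) :
    geomCoroot M i (geomRoot j) * geomCoroot M j (geomRoot i) - 2 =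
      2 * Real.cos (2 * (Real.pi / M i j)) := by
  rw [geomCoroot_root, geomCoroot_root, M.symmetric j i, Real.cos_two_mul]
  ring

theorem sin_two_mul_pi_div_ne_zero {m : ℕ} (hm : 3 ≤ m) :
    Real.sin (2 * (Real.pi / m)) ≠ 0 := by
  have h3 : (3 : ℝ) ≤ m := by exact_mod_cast hm
  have hpi := Real.pi_pos
  apply ne_of_gt
  apply Real.sin_pos_of_pos_of_lt_pi
  · positivity
  · rw [← mul_div_assoc, div_lt_iff₀ (by linarith)]
    nlinarith

theorem geomReflection_isLiftable : M.IsLiftable (geomReflection M) := by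
  intro i j
  by_cases hij : i = j
  · subst hij
    rw [M.diagonal, pow_one]
    exact LinearEquiv.ext (involutive_reflection (geomCoroot_root_self M i))
  have h1 : M i j ≠ 1 := M.off_diagonal i j hij
  obtain hm | hm | hm : M i j = 0 ∨ M i j = 2 ∨ 3 ≤ M i j := by omega
  · rw [hm, pow_zero]
  · have h₁ : geomCoroot M i (geomRoot j) = 0 := by simp [geomCoroot_root, hm]
    have h₂ : geomCoroot M j (geomRoot i) = 0 := by
      simp [geomCoroot_root, M.symmetric j i, hm]
    rw [hm]
    apply LinearEquiv.ext
    intro v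
    simp [pow_two, geomReflection, reflection_apply, h₁, h₂, geomCoroot_root_self]
    module
  · have hs := sin_two_mul_pi_div_ne_zero hm
    have hm0 : (M i j : ℝ) ≠ 0 := by
      have : M i j ≠ 0 := by omega
      exact_mod_cast this
    apply LinearEquiv.ext
    intro v
    rw [geomReflection, geomReflection, reflection_mul_reflection_pow_apply _ _ _ v _
      (geomCoroot_mul_sub_two M i j).symm]
    have key : ∀ k l : ℤ, k + l = M i j - 2 →
        (Polynomial.Chebyshev.S ℝ k).eval (2 * Real.cos (2 * (Real.pi / M i j))) +
        (Polynomial.Chebyshev.S ℝ l).eval (2 * Real.cos (2 * (Real.pi / M i j))) = 0 := by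
      intro k l hkl
      rw [← mul_eq_zero_iff_right hs, add_mul, chebyshevS_two_mul_cos, chebyshevS_two_mul_cos]
      have : ((l : ℝ) + 1) * (2 * (Real.pi / M i j)) =
          2 * Real.pi - ((k : ℝ) + 1) * (2 * (Real.pi / M i j)) := by
        have : (l : ℝ) = M i j - 2 - k := by
          have : l = M i j - 2 - k := by omega
          rw [this]; push_cast; ring
        rw [this]
        field_simp
        ring
      rw [this, Real.sin_two_pi_sub]
      ring
    obtain ⟨p, hp | hp⟩ : ∃ p : ℤ, (M i j : ℤ) = 2 * p ∨ (M i j : ℤ) = 2 * p + 1 :=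
      Int.even_or_odd' _
    · have h0 := key (p - 1) (p - 1) (by omega)
      have e1 : ((M i j : ℤ) - 2) / 2 = p - 1 := by omega
      have e2 : ((M i j : ℤ) - 1) / 2 = p - 1 := by omega
      have h0' : (Polynomial.Chebyshev.S ℝ (p - 1)).eval
        (2 * Real.cos (2 * (Real.pi / M i j))) = 0 := by linarith
      rw [e1, e2, h0']
      simp
    · have h0 := key p (p - 1) (by omega)
      have e1 : ((M i j : ℤ) - 1) / 2 = p := by omega
      have e2 : ((M i j : ℤ) - 3) / 2 = p - 1 := by omega
      have e3 : (M i j : ℤ) / 2 = p := by omega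
      have e4 : ((M i j : ℤ) - 2) / 2 = p - 1 := by omega
      rw [e1, e2, e3, e4, h0]
      simp

/-- In the geometric representation, the product of two distinct simple reflections has
order `M i j`. -/
theorem geomReflection_mul_pow_ne_one {i j : B} (hij : i ≠ j) {k : ℕ} (hk : 0 < k)
    (hkm : M i j = 0 ∨ k < M i j) : (geomReflection M i * geomReflection M j) ^ k ≠ 1 := by
  intro h
  have hv := LinearEquiv.congr_fun h (geomRoot i)
  rw [geomReflection, geomReflection, reflection_mul_reflection_pow_apply_self _ _ _ _
      (geomCoroot_mul_sub_two M i j).symm] at hv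
  have hcij : geomCoroot M j (geomRoot i) = -2 * Real.cos (Real.pi / M i j) := by
    rw [geomCoroot_root, M.symmetric j i]
  simp only [hcij] at hv
  have hi := DFunLike.congr_fun hv i
  have hj := DFunLike.congr_fun hv j
  simp only [geomRoot, Finsupp.coe_add, Finsupp.coe_smul, Pi.add_apply, Pi.smul_apply,
    Finsupp.single_eq_same, Finsupp.single_eq_of_ne hij, Finsupp.single_eq_of_ne hij.symm,
    smul_eq_mul, mul_one, mul_zero, add_zero, zero_add, LinearEquiv.coe_one, id_eq] at hi hj
  have h1 : M i j ≠ 1 := M.off_diagonal i j hij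
  obtain hm | hm | hm : M i j = 0 ∨ M i j = 2 ∨ 3 ≤ M i j := by omega
  · simp [hm, Polynomial.Chebyshev.S_eval_two] at hj
    omega
  · obtain rfl : k = 1 := by omega
    simp [hm] at hi
    rw [mul_div_cancel₀ _ (two_ne_zero' ℝ), Real.cos_pi] at hi
    norm_num at hi
  · have hs := sin_two_mul_pi_div_ne_zero hm
    have hkm' : k < M i j := by omega
    have hc : Real.cos (Real.pi / M i j) ≠ 0 := by
      intro h0
      rw [Real.sin_two_mul, h0, mul_zero] at hs
      exact hs rfl
    have hS : (Polynomial.Chebyshev.S ℝ (k - 1)).eval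
        (2 * Real.cos (2 * (Real.pi / M i j))) = 0 := by
      rcases mul_eq_zero.mp hj with h0 | h0
      · exact h0
      · exact absurd (by linarith) hc
    rw [hS, add_zero] at hi
    have e1 := chebyshevS_two_mul_cos (2 * (Real.pi / M i j)) (k - 1)
    have e2 := chebyshevS_two_mul_cos (2 * (Real.pi / M i j)) k
    rw [hS, zero_mul] at e1
    rw [hi, one_mul] at e2
    push_cast at e1 e2
    rw [sub_add_cancel] at e1
    rw [add_mul, one_mul, Real.sin_add, ← e1, zero_mul, zero_add] at e2
    have e3 : Real.cos (k * (2 * (Real.pi / M i j))) = 1 :=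
      mul_right_cancel₀ hs (by rw [one_mul]; exact e2.symm)
    have hpi := Real.pi_pos
    have hm0 : (0 : ℝ) < M i j := by exact_mod_cast (by omega : 0 < M i j)
    have hk0 : (0 : ℝ) < k := by exact_mod_cast hk
    have hkm'' : (k : ℝ) < M i j := by exact_mod_cast hkm'
    have hpos : 0 < (k : ℝ) * (2 * (Real.pi / M i j)) := by positivity
    rw [Real.cos_eq_one_iff_of_lt_of_lt (by linarith)] at e3
    · exact hpos.ne' e3
    · rw [show (k : ℝ) * (2 * (Real.pi / M i j)) = 2 * Real.pi * (k / M i j) by ring]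
      have : (k : ℝ) / M i j < 1 := by rwa [div_lt_one hm0]
      nlinarith

end GeometricRepresentation

section OrderOfProducts

variable {B W : Type*} [Group W] {M : CoxeterMatrix B} (cs : CoxeterSystem M W)

theorem simple_mul_simple_pow_ne_one {i j : B} (hij : i ≠ j) {k : ℕ} (hk : 0 < k)
    (hkm : M i j = 0 ∨ k < M i j) : (cs.simple i * cs.simple j) ^ k ≠ 1 := by
  intro h
  have h' := congrArg (cs.lift ⟨_, geomReflection_isLiftable M⟩) h
  rw [map_pow, map_mul, map_one, cs.lift_apply_simple, cs.lift_apply_simple] at h'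
  exact geomReflection_mul_pow_ne_one M hij hk hkm h'

theorem simple_injective : Function.Injective cs.simple := by
  intro i j h
  by_contra hij
  have h1 : M i j ≠ 1 := M.off_diagonal i j hij
  refine simple_mul_simple_pow_ne_one cs hij one_pos (by omega) ?_
  simp [h]

end OrderOfProducts

section StrongExchange

open CoxeterSystem

variable {B W : Type*} [Group W] {M : CoxeterMatrix B} (cs : CoxeterSystem M W)

open Classical in
/-- The action of a simple reflection on pairs consisting of an element of `W` and a sign;
it conjugates the element, and changes the sign when the element is that simple reflection. -/
noncomputable def signedConj (i : B) : Function.End (W × ZMod 2) := fun p =>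
  (cs.simple i * p.1 * cs.simple i, p.2 + if p.1 = cs.simple i then 1 else 0)

open Classical in
theorem prod_map_signedConj (ω : List B) (t : W) (e : ZMod 2) :
    (ω.map (signedConj cs)).prod (t, e) =
      (cs.wordProd ω * t * (cs.wordProd ω)⁻¹, e + ((cs.rightInvSeq ω).count t : ℕ)) := by
  induction ω with
  | nil =>
    simp
    rfl
  | cons i ω ih =>
    rw [List.map_cons, List.prod_cons]
    change signedConj cs i ((ω.map (signedConj cs)).prod (t, e)) = _
    rw [ih]
    simp only [signedConj, cs.wordProd_cons, rightInvSeq, List.count_cons, mul_inv_rev,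
      cs.inv_simple, mul_assoc, beq_iff_eq, Prod.mk.injEq, true_and]
    have : cs.wordProd ω * (t * (cs.wordProd ω)⁻¹) = cs.simple i ↔
        (cs.wordProd ω)⁻¹ * (cs.simple i * cs.wordProd ω) = t := by
      constructor
      · intro h; rw [← h]; group
      · intro h; rw [← h]; group
    simp only [this]
    split_ifs <;> simp [add_assoc]

theorem prod_map_reverse_alternatingWord {G : Type*} [Monoid G] (f : B → G) (i j : B) (p : ℕ) :
    ((alternatingWord j i (2 * p)).reverse.map f).prod = (f i * f j) ^ p := by
  induction p with
  | zero => simp [alternatingWord]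
  | succ p ih =>
    rw [show 2 * (p + 1) = 2 * p + 1 + 1 by ring, alternatingWord_succ, alternatingWord_succ,
      pow_succ', ← ih]
    simp [mul_assoc]

open Classical in
theorem even_count_leftInvSeq_alternatingWord (i j : B) (t : W) :
    Even ((cs.leftInvSeq (alternatingWord i j (2 * M i j))).count t) := by
  set L := cs.leftInvSeq (alternatingWord i j (2 * M i j)) with hL
  have hlen : L.length = 2 * M i j := by simp [hL]
  have hdrop : L.drop (M i j) = L.take (M i j) := by
    apply List.ext_getElem
    · simp [hlen]; omega
    · intro n h₁ h₂
      rw [List.length_take, hlen] at h₂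
      rw [List.getElem_drop, List.getElem_take]
      simp only [hL]
      rw [getElem_leftInvSeq_alternatingWord _ _ _ _ _ (by omega),
        getElem_leftInvSeq_alternatingWord _ _ _ _ _ (by omega),
        prod_alternatingWord_eq_mul_pow, prod_alternatingWord_eq_mul_pow,
        show (2 * (M i j + n) + 1) / 2 = M i j + n by omega,
        show (2 * n + 1) / 2 = n by omega, pow_add, simple_mul_simple_pow']
      simp
  rw [← List.take_append_drop (M i j) L, hdrop, List.count_append]
  exact ⟨_, rfl⟩

theorem signedConj_isLiftable : M.IsLiftable (signedConj cs) := by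
  classical
  intro i j
  rw [← prod_map_reverse_alternatingWord]
  funext ⟨t, e⟩
  have h1 : cs.wordProd (alternatingWord j i (2 * M i j)).reverse = 1 := by
    rw [wordProd, prod_map_reverse_alternatingWord, simple_mul_simple_pow]
  have h2 := even_count_leftInvSeq_alternatingWord cs j i t
  rw [M.symmetric j i] at h2
  rw [prod_map_signedConj, h1, rightInvSeq_reverse, List.count_reverse,
    (ZMod.natCast_eq_zero_iff_even).2 h2, inv_one, one_mul, mul_one, add_zero]
  rfl

/-- The parity of the number of occurrences of `t` in the right inversion sequence of any
word representing `w`. -/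
noncomputable def inversionParity (w t : W) : ZMod 2 :=
  (cs.lift ⟨_, signedConj_isLiftable cs⟩ w (t, 0)).2

theorem lift_signedConj_wordProd (ω : List B) :
    cs.lift ⟨_, signedConj_isLiftable cs⟩ (cs.wordProd ω) = (ω.map (signedConj cs)).prod := by
  rw [wordProd, map_list_prod, List.map_map]
  congr 2
  funext i
  exact cs.lift_apply_simple _ i

open Classical in
theorem inversionParity_wordProd (ω : List B) (t : W) :
    inversionParity cs (cs.wordProd ω) t = ((cs.rightInvSeq ω).count t : ℕ) := by
  rw [inversionParity, lift_signedConj_wordProd, prod_map_signedConj, zero_add]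

theorem inversionParity_mul (u v t : W) :
    inversionParity cs (u * v) t =
      inversionParity cs v t + inversionParity cs u (v * t * v⁻¹) := by
  classical
  obtain ⟨ω, rfl⟩ := cs.wordProd_surjective u
  obtain ⟨ω', rfl⟩ := cs.wordProd_surjective v
  rw [inversionParity_wordProd, inversionParity_wordProd, inversionParity, map_mul,
    lift_signedConj_wordProd, lift_signedConj_wordProd]
  change ((ω.map (signedConj cs)).prod ((ω'.map (signedConj cs)).prod (t, 0))).2 = _
  rw [prod_map_signedConj, prod_map_signedConj, zero_add]

theorem inversionParity_one (t : W) : inversionParity cs 1 t = 0 := by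
  classical
  rw [← cs.wordProd_nil, inversionParity_wordProd]
  simp

theorem inversionParity_self {t : W} (ht : cs.IsReflection t) : inversionParity cs t t = 1 := by
  classical
  obtain ⟨u, i, rfl⟩ := ht
  have h1 := inversionParity_mul cs u u⁻¹ (u * cs.simple i * u⁻¹)
  have h2 := inversionParity_mul cs (u * cs.simple i) u⁻¹ (u * cs.simple i * u⁻¹)
  have h3 := inversionParity_mul cs u (cs.simple i) (cs.simple i)
  have h4 : inversionParity cs (cs.simple i) (cs.simple i) = 1 := by
    rw [← cs.wordProd_singleton, inversionParity_wordProd]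
    simp [rightInvSeq]
  have e : u⁻¹ * (u * cs.simple i * u⁻¹) * (u⁻¹)⁻¹ = cs.simple i := by group
  rw [mul_inv_cancel, inversionParity_one, e] at h1
  rw [e, h3, h4, simple_mul_simple_self, one_mul, inv_simple] at h2
  rw [h2, add_left_comm, ← h1, add_zero]

/-- A reflection decreasing the length occurs in the right inversion sequence of every
word representing the element. -/
theorem mem_rightInvSeq_of_length_lt (ω : List B) {t : W} (ht : cs.IsReflection t)
    (hlt : cs.length (cs.wordProd ω * t) < cs.length (cs.wordProd ω)) :
    t ∈ cs.rightInvSeq ω := by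
  classical
  by_contra hmem
  obtain ⟨σ, hσ, hσw⟩ := cs.exists_isReduced (cs.wordProd ω * t)
  have h1 := inversionParity_mul cs (cs.wordProd ω) t t
  rw [inversionParity_self cs ht, mul_inv_cancel_right, inversionParity_wordProd,
    List.count_eq_zero_of_not_mem hmem, hσw, inversionParity_wordProd] at h1
  have hmem' : t ∈ cs.rightInvSeq σ := by
    by_contra h
    rw [List.count_eq_zero_of_not_mem h] at h1
    simp at h1
  have h2 := (cs.isRightInversion_of_mem_rightInvSeq hσ hmem').2
  rw [← hσw, mul_assoc, ht.mul_self, mul_one] at h2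
  omega

/-- The strong exchange condition. -/
theorem exists_mul_reflection_eq_eraseIdx (ω : List B) {t : W} (ht : cs.IsReflection t)
    (hlt : cs.length (cs.wordProd ω * t) < cs.length (cs.wordProd ω)) :
    ∃ k < ω.length, cs.wordProd ω * t = cs.wordProd (ω.eraseIdx k) := by
  obtain ⟨k, hk, rfl⟩ := List.getElem_of_mem (mem_rightInvSeq_of_length_lt cs ω ht hlt)
  refine ⟨k, by simpa using hk, ?_⟩
  rw [← wordProd_mul_getD_rightInvSeq, List.getD_eq_getElem _ _ hk]

theorem isReflection_conj_simple (w : W) (i : B) :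
    cs.IsReflection (w⁻¹ * cs.simple i * w) := ⟨w⁻¹, i, by simp⟩

/-- The exchange condition. -/
theorem exists_simple_mul_eq_eraseIdx (ω : List B) (i : B)
    (hlt : cs.length (cs.simple i * cs.wordProd ω) < cs.length (cs.wordProd ω)) :
    ∃ k < ω.length, cs.simple i * cs.wordProd ω = cs.wordProd (ω.eraseIdx k) := by
  have e : cs.wordProd ω * ((cs.wordProd ω)⁻¹ * cs.simple i * cs.wordProd ω) =
    cs.simple i * cs.wordProd ω := by group
  rw [← e] at hlt ⊢
  exact exists_mul_reflection_eq_eraseIdx cs ω (isReflection_conj_simple cs _ i) hlt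

/-- The deletion condition: every word contains a reduced word for the same element. -/
theorem exists_reduced_sublist (ω : List B) :
    ∃ σ, σ.Sublist ω ∧ cs.IsReduced σ ∧ cs.wordProd σ = cs.wordProd ω := by
  induction ω with
  | nil => exact ⟨[], List.Sublist.refl _, by simp [CoxeterSystem.IsReduced], rfl⟩
  | cons i ω ih =>
    obtain ⟨σ, hσ, hred, hprod⟩ := ih
    rcases cs.length_simple_mul (cs.wordProd σ) i with h | h
    · refine ⟨i :: σ, hσ.cons_cons i, ?_, ?_⟩
      · rw [CoxeterSystem.IsReduced, wordProd_cons, h, hred.eq, List.length_cons]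
      · rw [wordProd_cons, hprod, wordProd_cons]
    · obtain ⟨k, hk, hk'⟩ := exists_simple_mul_eq_eraseIdx cs σ i (by omega)
      refine ⟨σ.eraseIdx k, ((List.eraseIdx_sublist σ k).trans hσ).cons i, ?_, ?_⟩
      · have := hred.eq
        rw [CoxeterSystem.IsReduced, ← hk', List.length_eraseIdx_of_lt hk]
        omega
      · rw [← hk', hprod, wordProd_cons]

theorem isReduced_of_cons {i : B} {ω : List B} (h : cs.IsReduced (i :: ω)) : cs.IsReduced ω :=
  h.drop 1

theorem length_lt_of_isReduced_cons {i : B} {ω : List B} (h : cs.IsReduced (i :: ω)) :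
    cs.length (cs.wordProd ω) < cs.length (cs.simple i * cs.wordProd ω) := by
  rw [← wordProd_cons, h.eq, (isReduced_of_cons cs h).eq]
  simp

end StrongExchange

section Bruhat

open CoxeterSystem

variable {B W : Type*} [Group W] {M : CoxeterMatrix B} (cs : CoxeterSystem M W)

theorem exists_sublist_of_bruhatLE {x w : W} (h : bruhatLE cs x w) {ω : List B}
    (hω : cs.wordProd ω = w) : ∃ σ, σ.Sublist ω ∧ cs.wordProd σ = x := by
  induction h generalizing ω with
  | refl => exact ⟨ω, List.Sublist.refl _, hω⟩
  | tail _ hstep ih =>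
    obtain ⟨t, ht, rfl, hlt⟩ := hstep
    rename_i y _
    have e : cs.wordProd ω * t = y := by rw [hω, mul_assoc, ht.mul_self, mul_one]
    obtain ⟨k, -, hk⟩ := exists_mul_reflection_eq_eraseIdx cs ω ht (by rwa [e, hω])
    obtain ⟨σ, hσ, rfl⟩ := ih (hk.symm.trans e)
    exact ⟨σ, hσ.trans (List.eraseIdx_sublist ω k), rfl⟩

theorem bruhatLE_simple_mul_or {x y : W} (h : bruhatLE cs x y) (i : B) :
    bruhatLE cs (cs.simple i * x) y ∨ bruhatLE cs (cs.simple i * x) (cs.simple i * y) := by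
  induction h with
  | refl => exact .inr .refl
  | tail hxy hstep ih =>
    rename_i y z
    rcases ih with ih | ih
    · exact .inl (ih.tail hstep)
    · obtain ⟨t, ht, rfl, hlt⟩ := hstep
      by_cases heq : cs.simple i * y = y * t
      · exact .inl (heq ▸ ih)
      refine .inr (ih.tail ⟨t, ht, by rw [mul_assoc], ?_⟩)
      by_contra hnot
      have hne := ht.length_mul_left_ne (cs.simple i * y)
      obtain ⟨ω, hω, rfl⟩ := cs.exists_isReduced y
      rw [← mul_assoc, ← wordProd_cons] at hnot
      rw [← wordProd_cons] at hne
      obtain ⟨k, hk, hk'⟩ := exists_mul_reflection_eq_eraseIdx cs (i :: ω) ht (by omega)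
      cases k with
      | zero =>
        rw [List.eraseIdx_cons_zero, wordProd_cons] at hk'
        apply heq
        nth_rewrite 1 [← hk']
        rw [mul_assoc, simple_mul_simple_cancel_left]
      | succ k =>
        rw [List.eraseIdx_cons_succ, wordProd_cons, wordProd_cons, mul_assoc, mul_right_inj] at hk'
        have h1 := cs.length_wordProd_le (ω.eraseIdx k)
        have h2 := List.eraseIdx_sublist ω k |>.length_le
        rw [hk', hω.eq] at hlt
        omega

theorem bruhatLE_simple_mul {y : W} {i : B}
    (h : cs.length y < cs.length (cs.simple i * y)) : bruhatLE cs y (cs.simple i * y) :=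
  .single ⟨_, isReflection_conj_simple cs y i, by group, h⟩

theorem bruhatLE_of_sublist {σ ω : List B} (hω : cs.IsReduced ω) (h : σ.Sublist ω) :
    bruhatLE cs (cs.wordProd σ) (cs.wordProd ω) := by
  induction h with
  | slnil => exact .refl
  | cons i _ ih =>
    rw [wordProd_cons]
    exact (ih (isReduced_of_cons cs hω)).trans
      (bruhatLE_simple_mul cs (length_lt_of_isReduced_cons cs hω))
  | cons_cons i _ ih =>
    rw [wordProd_cons, wordProd_cons]
    rcases bruhatLE_simple_mul_or cs (ih (isReduced_of_cons cs hω)) i with h | h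
    · exact h.trans (bruhatLE_simple_mul cs (length_lt_of_isReduced_cons cs hω))
    · exact h

end Bruhat

section AlternatingWords

open CoxeterSystem

variable {B W : Type*} [Group W] {M : CoxeterMatrix B} (cs : CoxeterSystem M W)

theorem length_altW (i j : B) (n : ℕ) : (altW i j n).length = n := by
  induction n generalizing i j with
  | zero => rfl
  | succ n ih => simp [altW, ih]

theorem mem_altW {i j x : B} {n : ℕ} (h : x ∈ altW i j n) : x = i ∨ x = j := by
  induction n generalizing i j with
  | zero => simp [altW] at h
  | succ n ih =>
    rcases List.mem_cons.1 h with h | h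
    · exact .inl h
    · exact (ih h).symm

theorem reverse_altW (i j : B) (n : ℕ) : (altW i j n).reverse = alternatingWord j i n := by
  induction n generalizing i j with
  | zero => rfl
  | succ n ih => simp [altW, ih, alternatingWord]

theorem wordProd_altW_two_mul (i j : B) (k : ℕ) :
    cs.wordProd (altW i j (2 * k)) = (cs.simple i * cs.simple j) ^ k := by
  induction k with
  | zero => simp [altW]
  | succ k ih =>
    rw [show 2 * (k + 1) = 2 * k + 1 + 1 by ring, altW, altW, wordProd_cons, wordProd_cons, ih,
      pow_succ', mul_assoc]

theorem wordProd_altW_two_mul_add_one (i j : B) (k : ℕ) :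
    cs.wordProd (altW i j (2 * k + 1)) = cs.simple i * (cs.simple j * cs.simple i) ^ k := by
  rw [altW, wordProd_cons, wordProd_altW_two_mul]

theorem wordProd_altW_braid (i j : B) :
    cs.wordProd (altW i j (M i j)) = cs.wordProd (altW j i (M j i)) := by
  rw [← inv_inj, ← wordProd_reverse, ← wordProd_reverse, reverse_altW, reverse_altW,
    M.symmetric j i]
  have := cs.wordProd_braidWord_eq j i
  rwa [braidWord, braidWord, M.symmetric j i] at this

theorem length_wordProd_mod_two (ω : List B) :
    cs.length (cs.wordProd ω) % 2 = ω.length % 2 := by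
  induction ω with
  | nil => simp
  | cons i ω ih =>
    rw [wordProd_cons, List.length_cons]
    rcases cs.length_simple_mul (cs.wordProd ω) i with h | h <;> omega

theorem ne_of_isReduced_cons_cons {x y : B} {ω : List B} (h : cs.IsReduced (x :: y :: ω)) :
    x ≠ y := by
  rintro rfl
  have h1 := h.eq
  rw [wordProd_cons, wordProd_cons, simple_mul_simple_cancel_left] at h1
  have h2 := cs.length_wordProd_le ω
  simp at h1
  omega

theorem length_le_one_of_isReduced {c : B} {ω : List B} (h : cs.IsReduced ω)
    (hc : ∀ x ∈ ω, x = c) : ω.length ≤ 1 := by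
  match ω with
  | [] => simp
  | [_] => simp
  | x :: y :: ω =>
    exact absurd ((hc x (by simp)).trans (hc y (by simp)).symm) (ne_of_isReduced_cons_cons cs h)

theorem eq_altW_of_isReduced {i j : B} {ω : List B} (h : cs.IsReduced ω)
    (hω : ∀ x ∈ ω, x = i ∨ x = j) :
    ω = altW i j ω.length ∨ ω = altW j i ω.length := by
  induction ω with
  | nil => exact .inl rfl
  | cons x ω ih =>
    have ih := ih (isReduced_of_cons cs h) fun y hy => hω y (List.mem_cons_of_mem _ hy)
    cases ω with
    | nil =>
      rcases hω x (by simp) with rfl | rfl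
      · exact .inl rfl
      · exact .inr rfl
    | cons y ω =>
      have hne := ne_of_isReduced_cons_cons cs h
      have hx := hω x (by simp)
      rcases ih with ih | ih
      · have hy : y = i := (List.cons.inj ih).1
        right
        rw [List.length_cons, altW, ← ih, hx.resolve_left (hy ▸ hne)]
      · have hy : y = j := (List.cons.inj ih).1
        left
        rw [List.length_cons, altW, ← ih, hx.resolve_right (hy ▸ hne)]

theorem isReduced_altW {i j : B} (hij : i ≠ j) {n : ℕ} (hn : M i j = 0 ∨ n ≤ M i j) :
    cs.IsReduced (altW i j n) := by
  obtain ⟨σ, hσ, hred, hprod⟩ := exists_reduced_sublist cs (altW i j n)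
  have hle := hσ.length_le
  rw [length_altW] at hle
  rcases hle.eq_or_lt with heq | hlt
  · rwa [hσ.eq_of_length (by rw [heq, length_altW])] at hred
  exfalso
  have hpar : σ.length % 2 = n % 2 := by
    rw [← length_wordProd_mod_two cs σ, hprod, length_wordProd_mod_two, length_altW]
  have key := @simple_mul_simple_pow_ne_one B W _ M cs i j hij
  have hinv : cs.simple j * cs.simple i = (cs.simple i * cs.simple j)⁻¹ := by simp
  rcases eq_altW_of_isReduced cs hred fun x hx => mem_altW (hσ.subset hx) with h | h
  · rw [h] at hprod
    rcases Nat.even_or_odd' n with ⟨p, rfl | rfl⟩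
    · obtain ⟨q, hq⟩ : ∃ q, σ.length = 2 * q := ⟨σ.length / 2, by omega⟩
      rw [hq, wordProd_altW_two_mul, wordProd_altW_two_mul] at hprod
      refine key (k := p - q) (by omega) (by omega) ?_
      rw [pow_sub _ (by omega), hprod, mul_inv_cancel]
    · obtain ⟨q, hq⟩ : ∃ q, σ.length = 2 * q + 1 := ⟨σ.length / 2, by omega⟩
      rw [hq, wordProd_altW_two_mul_add_one, wordProd_altW_two_mul_add_one, mul_right_inj, hinv,
        inv_pow, inv_pow, inv_inj] at hprod
      refine key (k := p - q) (by omega) (by omega) ?_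
      rw [pow_sub _ (by omega), hprod, mul_inv_cancel]
  · rw [h] at hprod
    rcases Nat.even_or_odd' n with ⟨p, rfl | rfl⟩
    · obtain ⟨q, hq⟩ : ∃ q, σ.length = 2 * q := ⟨σ.length / 2, by omega⟩
      rw [hq, wordProd_altW_two_mul, wordProd_altW_two_mul, hinv, inv_pow] at hprod
      refine key (k := p + q) (by omega) (by omega) ?_
      rw [pow_add, ← hprod, inv_mul_cancel]
    · obtain ⟨q, hq⟩ : ∃ q, σ.length = 2 * q + 1 := ⟨σ.length / 2, by omega⟩
      rw [hq, wordProd_altW_two_mul_add_one, wordProd_altW_two_mul_add_one, hinv, inv_pow] at hprod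
      refine key (k := q + p + 1) (by omega) (by omega) ?_
      rw [show q + p + 1 = 1 + q + p by ring, pow_add, pow_add, pow_one, mul_assoc (cs.simple i),
        hprod, simple_mul_simple_cancel_left, inv_mul_cancel]

theorem le_of_isReduced_altW {i j : B} {n : ℕ} (hM : M i j ≠ 0) (h : cs.IsReduced (altW i j n)) :
    n ≤ M i j := by
  by_contra hn
  rw [← isReduced_reverse_iff, reverse_altW] at h
  rw [M.symmetric i j] at hM hn
  exact cs.not_isReduced_alternatingWord j i hM (by omega) h

theorem eq_of_simple_eq_wordProd {i : B} {τ : List B} (h : cs.simple i = cs.wordProd τ) :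
    i ∈ τ := by
  obtain ⟨σ, hσ, hred, hprod⟩ := exists_reduced_sublist cs τ
  have h1 := hred.eq
  rw [hprod, ← h, length_simple] at h1
  obtain ⟨j, rfl⟩ := List.length_eq_one_iff.1 h1.symm
  rw [← h, wordProd_singleton] at hprod
  obtain rfl := simple_injective cs hprod
  exact hσ.subset (by simp)

/-- Every letter of a reduced word occurs in every word for the same element. -/
theorem subset_of_isReduced {ω τ : List B} (h : cs.IsReduced ω)
    (hprod : cs.wordProd ω = cs.wordProd τ) : ω ⊆ τ := by
  induction ω generalizing τ with
  | nil => simp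
  | cons i ω ih =>
    have hlt := length_lt_of_isReduced_cons cs h
    rw [wordProd_cons] at hprod
    have hω : cs.wordProd ω = cs.simple i * cs.wordProd τ := by
      rw [← hprod, simple_mul_simple_cancel_left]
    rw [hprod, hω] at hlt
    obtain ⟨k, -, hk⟩ := exists_simple_mul_eq_eraseIdx cs τ i hlt
    have hsub := (List.eraseIdx_sublist τ k).subset
    refine List.cons_subset.2 ⟨?_,
      List.Subset.trans (ih (isReduced_of_cons cs h) (hω.trans hk)) hsub⟩
    have hi : cs.simple i = cs.wordProd (τ.eraseIdx k ++ τ.reverse) := by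
      rw [wordProd_append, ← hk, wordProd_reverse, mul_inv_cancel_right]
    rcases List.mem_append.1 (eq_of_simple_eq_wordProd cs hi) with h | h
    · exact hsub h
    · exact List.mem_reverse.1 h

theorem isReduced_append {a : B} {ω τ : List B} (hω : cs.IsReduced ω) (hτ : cs.IsReduced τ)
    (hinter : ∀ x ∈ ω, x ∈ τ → x = a) (ha : cs.IsReduced (a :: τ)) :
    cs.IsReduced (ω ++ τ) := by
  induction ω with
  | nil => exact hτ
  | cons i ω ih =>
    have ih := ih (isReduced_of_cons cs hω) fun x hx => hinter x (List.mem_cons_of_mem _ hx)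
    rcases cs.length_simple_mul (cs.wordProd (ω ++ τ)) i with h | h
    · rw [List.cons_append, CoxeterSystem.IsReduced, wordProd_cons, h, ih.eq, List.length_cons]
    exfalso
    obtain ⟨k, hk, hprod⟩ := exists_simple_mul_eq_eraseIdx cs (ω ++ τ) i (by omega)
    rcases lt_or_ge k ω.length with hkω | hkω
    · rw [List.eraseIdx_append_of_lt_length hkω, wordProd_append, wordProd_append, ← mul_assoc,
        mul_left_inj, ← wordProd_cons] at hprod
      have h1 := hω.eq
      have h2 := cs.length_wordProd_le (ω.eraseIdx k)
      rw [List.length_eraseIdx_of_lt hkω, ← hprod, h1, List.length_cons] at h2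
      omega
    · rw [List.eraseIdx_append_of_length_le hkω, wordProd_append, wordProd_append] at hprod
      set k' := k - ω.length with hk'
      have hk'lt : k' < τ.length := by
        rw [List.length_append] at hk
        omega
      have hlen := cs.length_wordProd_le (τ.eraseIdx k')
      rw [List.length_eraseIdx_of_lt hk'lt] at hlen
      have hτ' := hτ.eq
      obtain ⟨σ, hσ, hred, hσprod⟩ := exists_reduced_sublist cs (ω.reverse ++ i :: ω)
      have hz : cs.wordProd σ = cs.wordProd (τ.eraseIdx k' ++ τ.reverse) := by
        rw [hσprod, wordProd_append, wordProd_append, wordProd_cons, wordProd_reverse,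
          wordProd_reverse, eq_mul_inv_iff_mul_eq, mul_assoc, mul_assoc, hprod,
          inv_mul_cancel_left]
      have hz' : cs.wordProd σ * cs.wordProd τ = cs.wordProd (τ.eraseIdx k') := by
        rw [hz, wordProd_append, wordProd_reverse, inv_mul_cancel_right]
      have hall : ∀ x ∈ σ, x = a := by
        intro x hx
        have h1 := hσ.subset hx
        have h2 := subset_of_isReduced cs hred hz hx
        have h3 := (List.eraseIdx_sublist τ k').subset (a := x)
        simp only [List.mem_append, List.mem_reverse, List.mem_cons] at h1 h2
        exact hinter x (List.mem_cons.2 (by tauto)) (by tauto)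
      have hle := length_le_one_of_isReduced cs hred hall
      match σ, hle with
      | [], _ =>
        rw [wordProd_nil, one_mul] at hz'
        rw [← hz'] at hlen
        omega
      | [y], _ =>
        have hy := hall y (by simp)
        rw [hy, wordProd_singleton] at hz'
        have := length_lt_of_isReduced_cons cs ha
        rw [hz'] at this
        omega

theorem exists_word_of_mem_dihedral {i j : B} {v : W} (hv : v ∈ dihedral cs i j) :
    ∃ ω : List B, (∀ x ∈ ω, x = i ∨ x = j) ∧ cs.wordProd ω = v := by
  refine Subgroup.closure_induction (p := fun v _ =>
    ∃ ω : List B, (∀ x ∈ ω, x = i ∨ x = j) ∧ cs.wordProd ω = v) ?_ ?_ ?_ ?_ hv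
  · rintro x (rfl | rfl)
    · exact ⟨[i], by simp, by simp⟩
    · exact ⟨[j], by simp, by simp⟩
  · exact ⟨[], by simp, by simp⟩
  · rintro _ _ _ _ ⟨ω, hω, rfl⟩ ⟨τ, hτ, rfl⟩
    refine ⟨ω ++ τ, ?_, by rw [wordProd_append]⟩
    intro x hx
    exact (List.mem_append.1 hx).elim (hω x) (hτ x)
  · rintro _ _ ⟨ω, hω, rfl⟩
    exact ⟨ω.reverse, fun x hx => hω x (List.mem_reverse.1 hx), by rw [wordProd_reverse]⟩

theorem wordProd_mem_dihedral {i j : B} {ω : List B} (h : ∀ x ∈ ω, x = i ∨ x = j) :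
    cs.wordProd ω ∈ dihedral cs i j := by
  refine Subgroup.list_prod_mem _ fun x hx => ?_
  obtain ⟨y, hy, rfl⟩ := List.mem_map.1 hx
  apply Subgroup.subset_closure
  rcases h y hy with rfl | rfl <;> simp

theorem inv_mem_dihedral {i j : B} {v : W} (h : v ∈ dihedral cs i j) :
    v⁻¹ ∈ dihedral cs i j :=
  Subgroup.inv_mem _ h

/-- Every element of a standard dihedral subgroup is a product of an optional `a` and an
alternating word starting with `b`. -/
theorem exists_altW_of_mem_dihedral {a b : B} {v : W}
    (hM : M a b ≠ 0) (hv : v ∈ dihedral cs a b) :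
    ∃ q, q + 1 ≤ M a b ∧
      (v = cs.wordProd (altW b a q) ∨ v = cs.simple a * cs.wordProd (altW b a q)) := by
  obtain ⟨τ, hτ, rfl⟩ := exists_word_of_mem_dihedral cs hv
  obtain ⟨ω, hω, hred, hprod⟩ := exists_reduced_sublist cs τ
  rw [← hprod]
  rcases eq_altW_of_isReduced cs hred fun x hx => hτ x (hω.subset hx) with h | h
  · generalize ω.length = n at h
    subst h
    cases n with
    | zero => exact ⟨0, by omega, .inl rfl⟩
    | succ n => exact ⟨n, le_of_isReduced_altW cs hM hred, .inr (by rw [altW, wordProd_cons])⟩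
  · generalize ω.length = n at h
    subst h
    have hle := le_of_isReduced_altW cs (M.symmetric a b ▸ hM) hred
    rcases hle.eq_or_lt with rfl | hlt
    · refine ⟨M a b - 1, by omega, .inr ?_⟩
      rw [wordProd_altW_braid, ← wordProd_cons]
      exact congrArg (fun n => cs.wordProd (altW a b n)) (by omega : M a b = M a b - 1 + 1)
    · exact ⟨n, by rw [M.symmetric a b]; omega, .inl rfl⟩

theorem exists_sublists_of_bruhatLE {τ ω₁ ω₂ : List B} (hτ : cs.IsReduced τ)
    (h : bruhatLE cs (cs.wordProd τ) (cs.wordProd (ω₁ ++ ω₂))) :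
    ∃ σ₁ σ₂, σ₁.Sublist ω₁ ∧ σ₂.Sublist ω₂ ∧ cs.IsReduced σ₁ ∧ cs.IsReduced σ₂ ∧
      σ₁ ⊆ τ ∧ σ₂ ⊆ τ ∧ σ₁.length + σ₂.length = τ.length := by
  obtain ⟨ρ, hρ, hρprod⟩ := exists_sublist_of_bruhatLE cs h rfl
  obtain ⟨σ, hσ, hred, hprod⟩ := exists_reduced_sublist cs ρ
  obtain ⟨σ₁, σ₂, rfl, h₁, h₂⟩ := List.sublist_append_iff.1 (hσ.trans hρ)
  have hsub := subset_of_isReduced cs hred (hprod.trans hρprod)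
  refine ⟨σ₁, σ₂, h₁, h₂, ?_, ?_, List.Subset.trans (List.subset_append_left _ _) hsub,
    List.Subset.trans (List.subset_append_right _ _) hsub, ?_⟩
  · simpa using hred.take σ₁.length
  · simpa using hred.drop σ₁.length
  · rw [← List.length_append, ← hred.eq, hprod, hρprod, hτ.eq]

end AlternatingWords

section FullElements

open CoxeterSystem

variable {B W : Type*} [Group W] {M : CoxeterMatrix B} (cs : CoxeterSystem M W)

theorem IsFullWrt.isReduced_altW {w : W} (h : IsFullWrt cs Set.univ w) {i j : B} (hij : i ≠ j) :
    cs.IsReduced (altW i j (M i j)) ∧ bruhatLE cs (cs.wordProd (altW i j (M i j))) w :=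
  ⟨_root_.isReduced_altW cs hij (.inr le_rfl), (h i trivial j trivial hij).2⟩

/-- A full element represented by a word in `a, b'` followed by a word in `a, b` forces the
second word to be at least as long as `M a b - 1`. -/
theorem le_length_add_one_of_full {a b b' : B} (hab : a ≠ b) (hbb' : b ≠ b') {ω₁ ω₂ : List B}
    (h₁ : ∀ x ∈ ω₁, x = a ∨ x = b') (h : IsFullWrt cs Set.univ (cs.wordProd (ω₁ ++ ω₂))) :
    M a b ≤ ω₂.length + 1 := by
  obtain ⟨hred, hle⟩ := IsFullWrt.isReduced_altW cs h hab
  obtain ⟨σ₁, σ₂, hσ₁, hσ₂, hred₁, -, hsub, -, hlen⟩ := exists_sublists_of_bruhatLE cs hred hle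
  rw [length_altW] at hlen
  have := length_le_one_of_isReduced cs (c := a) hred₁ fun x hx => by
    rcases mem_altW (hsub hx) with hx' | rfl
    · exact hx'
    · exact (h₁ x (hσ₁.subset hx)).resolve_right hbb'
  have := hσ₂.length_le
  omega

theorem le_length_add_one_of_full' {a b b' : B} (hab' : a ≠ b') (hbb' : b ≠ b') {ω₁ ω₂ : List B}
    (h₂ : ∀ x ∈ ω₂, x = a ∨ x = b) (h : IsFullWrt cs Set.univ (cs.wordProd (ω₁ ++ ω₂))) :
    M a b' ≤ ω₁.length + 1 := by
  obtain ⟨hred, hle⟩ := IsFullWrt.isReduced_altW cs h hab'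
  obtain ⟨σ₁, σ₂, hσ₁, hσ₂, -, hred₂, -, hsub, hlen⟩ := exists_sublists_of_bruhatLE cs hred hle
  rw [length_altW] at hlen
  have := length_le_one_of_isReduced cs (c := a) hred₂ fun x hx => by
    rcases mem_altW (hsub hx) with hx' | rfl
    · exact hx'
    · exact (h₂ x (hσ₂.subset hx)).resolve_right hbb'.symm
  have := hσ₁.length_le
  omega

theorem le_two_of_full {a b b' : B} (hab : a ≠ b) (hab' : a ≠ b') (hbb' : b ≠ b')
    {ω₁ ω₂ : List B} (h₁ : ∀ x ∈ ω₁, x = a ∨ x = b') (h₂ : ∀ x ∈ ω₂, x = a ∨ x = b)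
    (h : IsFullWrt cs Set.univ (cs.wordProd (ω₁ ++ ω₂))) : M b b' ≤ 2 := by
  obtain ⟨hred, hle⟩ := IsFullWrt.isReduced_altW cs h hbb'
  obtain ⟨σ₁, σ₂, hσ₁, hσ₂, hred₁, hred₂, hsub₁, hsub₂, hlen⟩ :=
    exists_sublists_of_bruhatLE cs hred hle
  rw [length_altW] at hlen
  have := length_le_one_of_isReduced cs (c := b') hred₁ fun x hx => by
    rcases mem_altW (hsub₁ hx), h₁ x (hσ₁.subset hx) with ⟨rfl | rfl, hx' | hx'⟩ <;> grind
  have := length_le_one_of_isReduced cs (c := b) hred₂ fun x hx => by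
    rcases mem_altW (hsub₂ hx), h₂ x (hσ₂.subset hx) with ⟨rfl | rfl, hx' | hx'⟩ <;> grind
  omega

theorem isFullWrt_of_sublists {a b b' : B} (hall : ∀ i : B, i = a ∨ i = b ∨ i = b')
    (hne : a ≠ b') (h₂ : M b b' = 2) (hMab : M a b ≠ 0) (hMab' : M a b' ≠ 0) {ω : List B}
    (hω : cs.IsReduced ω) (hωab : (altW a b (M a b)).Sublist ω)
    (hωab' : (altW a b' (M a b')).reverse.Sublist ω) (hωbb' : [b', b].Sublist ω) :
    IsFullWrt cs Set.univ (cs.wordProd ω) := by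
  have hsymm : ∀ i j, (M i j ≠ 0 ∧ bruhatLE cs (cs.wordProd (altW i j (M i j))) (cs.wordProd ω)) →
      (M j i ≠ 0 ∧ bruhatLE cs (cs.wordProd (altW j i (M j i))) (cs.wordProd ω)) := by
    intro i j h
    rwa [wordProd_altW_braid, M.symmetric i j] at h
  have hab := And.intro hMab (bruhatLE_of_sublist cs hω hωab)
  have hab' : M a b' ≠ 0 ∧ bruhatLE cs (cs.wordProd (altW a b' (M a b'))) (cs.wordProd ω) := by
    refine ⟨hMab', ?_⟩
    have h := bruhatLE_of_sublist cs hω hωab'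
    have hlen : (altW a b' (M a b')).reverse.length = M a b' := by
      rw [List.length_reverse, length_altW]
    rcases eq_altW_of_isReduced cs (isReduced_altW cs hne (.inr le_rfl)).reverse
      fun x hx => mem_altW (List.mem_reverse.1 hx) with e | e
    · rwa [e, hlen] at h
    · rwa [e, hlen, M.symmetric a b', ← wordProd_altW_braid] at h
  have hbb' : M b' b ≠ 0 ∧ bruhatLE cs (cs.wordProd (altW b' b (M b' b))) (cs.wordProd ω) := by
    rw [M.symmetric b' b, h₂]
    exact ⟨two_ne_zero, bruhatLE_of_sublist cs hω hωbb'⟩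
  intro i _ j _ hij
  rcases hall i with rfl | rfl | rfl <;> rcases hall j with rfl | rfl | rfl <;>
    first
    | exact absurd rfl hij
    | assumption
    | (apply hsymm; assumption)

end FullElements

section ProductOfDihedral

open CoxeterSystem

variable {B W : Type*} [Group W] {M : CoxeterMatrix B} (cs : CoxeterSystem M W)

theorem not_isFullWrt_of_mem_dihedral_mul {a b b' : B} (hab : a ≠ b) (hab' : a ≠ b')
    (hbb' : b ≠ b') (hM : M b b' = 0 ∨ 2 < M b b' ∨ M a b = 0 ∨ M a b' = 0) {u v : W}
    (hu : u ∈ dihedral cs a b') (hv : v ∈ dihedral cs a b) :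
    ¬ IsFullWrt cs Set.univ (u * v) := by
  intro hfull
  have hne := (hfull b trivial b' trivial hbb').1
  have hne_ab := (hfull a trivial b trivial hab).1
  have hne_ab' := (hfull a trivial b' trivial hab').1
  obtain ⟨ω₁, h₁, rfl⟩ := exists_word_of_mem_dihedral cs hu
  obtain ⟨ω₂, h₂, rfl⟩ := exists_word_of_mem_dihedral cs hv
  rw [← wordProd_append] at hfull
  have hle := le_two_of_full cs hab hab' hbb' h₁ h₂ hfull
  omega

/-- Every element of `⟨a, b'⟩⟨a, b⟩` is a product of a word ending with `b'`, an optional `a`, and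
a word starting with `b`. -/
theorem exists_altW_of_mem_dihedral_mul {a b b' : B} (hMab : M a b ≠ 0) (hMab' : M a b' ≠ 0)
    {u v : W} (hu : u ∈ dihedral cs a b') (hv : v ∈ dihedral cs a b) :
    ∃ p q, p + 1 ≤ M a b' ∧ q + 1 ≤ M a b ∧ ∃ l : List B, (l = [] ∨ l = [a]) ∧
      u * v = cs.wordProd ((altW b' a p).reverse ++ l ++ altW b a q) := by
  obtain ⟨q, hq, hv⟩ := exists_altW_of_mem_dihedral cs hMab hv
  obtain ⟨p, hp, hu⟩ := exists_altW_of_mem_dihedral cs hMab' (inv_mem_dihedral cs hu)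
  refine ⟨p, q, hp, hq, ?_⟩
  have hu : u = cs.wordProd (altW b' a p).reverse ∨
      u = cs.wordProd (altW b' a p).reverse * cs.simple a := by
    rw [wordProd_reverse]
    rwa [← inv_eq_iff_eq_inv, ← cs.inv_simple a, ← mul_inv_rev, ← inv_eq_iff_eq_inv]
  rcases hu with rfl | rfl <;> rcases hv with rfl | rfl
  · exact ⟨[], .inl rfl, by simp [wordProd_append]⟩
  · exact ⟨[a], .inr rfl, by simp [wordProd_append, wordProd_cons]⟩
  · exact ⟨[a], .inr rfl, by simp [wordProd_append, wordProd_cons, mul_assoc]⟩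
  · exact ⟨[], .inl rfl, by simp [wordProd_append, mul_assoc]⟩

theorem eq_of_isFullWrt_of_mem_dihedral_mul {a b b' : B} (hab : a ≠ b) (hab' : a ≠ b')
    (hbb' : b ≠ b') (hMab : M a b ≠ 0) (hMab' : M a b' ≠ 0) {u v : W}
    (hu : u ∈ dihedral cs a b') (hv : v ∈ dihedral cs a b)
    (hfull : IsFullWrt cs Set.univ (u * v)) :
    u * v = cs.wordProd ((altW b' a (M a b' - 1)).reverse ++ altW b a (M a b - 1)) ∨
      u * v = cs.wordProd ((altW b' a (M a b' - 1)).reverse ++ a :: altW b a (M a b - 1)) := by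
  obtain ⟨p, q, hp, hq, l, hl, huv⟩ := exists_altW_of_mem_dihedral_mul cs hMab hMab' hu hv
  rw [huv] at hfull ⊢
  have hla : ∀ x ∈ l, x = a := by rcases hl with rfl | rfl <;> simp
  have hq' := le_length_add_one_of_full cs hab hbb' (fun x hx => by
    rcases List.mem_append.1 hx with hx | hx
    · exact (mem_altW (List.mem_reverse.1 hx)).symm
    · exact .inl (hla x hx)) hfull
  rw [List.append_assoc] at hfull
  have hp' := le_length_add_one_of_full' cs hab' hbb' (fun x hx => by
    rcases List.mem_append.1 hx with hx | hx
    · exact .inl (hla x hx)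
    · exact (mem_altW hx).symm) hfull
  rw [List.length_reverse, length_altW] at hp'
  rw [length_altW] at hq'
  obtain rfl : p = M a b' - 1 := by omega
  obtain rfl : q = M a b - 1 := by omega
  rcases hl with rfl | rfl <;> simp

theorem altW_succ_pred {i j : B} {n : ℕ} (hn : n ≠ 0) : i :: altW j i (n - 1) = altW i j n := by
  obtain ⟨n, rfl⟩ := Nat.exists_eq_succ_of_ne_zero hn
  rfl

theorem isFullWrt_words {a b b' : B} (hab : a ≠ b) (hab' : a ≠ b') (hbb' : b ≠ b')
    (hall : ∀ i : B, i = a ∨ i = b ∨ i = b') (h₂ : M b b' = 2) (hMab : 3 ≤ M a b)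
    (hMab' : 3 ≤ M a b') :
    IsFullWrt cs Set.univ
        (cs.wordProd ((altW b' a (M a b' - 1)).reverse ++ altW b a (M a b - 1))) ∧
      IsFullWrt cs Set.univ
        (cs.wordProd ((altW b' a (M a b' - 1)).reverse ++ a :: altW b a (M a b - 1))) := by
  have e : a :: altW b a (M a b - 1) = altW a b (M a b) := altW_succ_pred (by omega)
  have e' : (altW b' a (M a b' - 1)).reverse ++ [a] = (altW a b' (M a b')).reverse := by
    rw [← altW_succ_pred (i := a) (by omega), List.reverse_cons]
  have hτ : cs.IsReduced (a :: altW b a (M a b - 1)) :=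
    e ▸ isReduced_altW cs hab (.inr le_rfl)
  have hω : cs.IsReduced ((altW b' a (M a b' - 1)).reverse ++ [a]) :=
    e' ▸ (isReduced_altW cs hab' (.inr le_rfl)).reverse
  have hinter : ∀ x, x = b' ∨ x = a → x = b ∨ x = a → x = a := by
    rintro x (rfl | rfl) (h | h)
    · exact absurd h.symm hbb'
    all_goals exact h ▸ rfl
  have hmem : [b, a].Sublist (altW b a (M a b - 1)) := by
    rw [show M a b - 1 = M a b - 3 + 1 + 1 by omega]
    simp [altW]
  have hmem' : [a, b'].Sublist (altW b' a (M a b' - 1)).reverse := by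
    rw [show M a b' - 1 = M a b' - 3 + 1 + 1 by omega]
    simp [altW]
  have hsub : ((altW b' a (M a b' - 1)).reverse ++ altW b a (M a b - 1)).Sublist
      ((altW b' a (M a b' - 1)).reverse ++ a :: altW b a (M a b - 1)) :=
    (List.sublist_cons_self _ _).append_left _
  have hsub_bb' : [b', b].Sublist
      ((altW b' a (M a b' - 1)).reverse ++ altW b a (M a b - 1)) :=
    ((List.sublist_cons_self a [b']).trans hmem').append
      ((List.singleton_sublist.2 (by simp)).trans hmem)
  have hsub_ab : (altW a b (M a b)).Sublist
      ((altW b' a (M a b' - 1)).reverse ++ altW b a (M a b - 1)) :=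
    e ▸ (((List.singleton_sublist.2 (by simp)).trans hmem').append (.refl _) : ([a] ++ _).Sublist _)
  have hsub_ab' : (altW a b' (M a b')).reverse.Sublist
      ((altW b' a (M a b' - 1)).reverse ++ altW b a (M a b - 1)) :=
    e' ▸ (List.Sublist.refl _).append ((List.sublist_cons_self b [a]).trans hmem)
  constructor
  · refine isFullWrt_of_sublists cs hall hab' h₂ (by omega) (by omega) ?_ hsub_ab hsub_ab' hsub_bb'
    refine isReduced_append cs ?_ (isReduced_of_cons cs hτ) (fun x h h' => hinter x ?_ ?_) hτ
    · simpa using hω.take (altW b' a (M a b' - 1)).reverse.length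
    · exact mem_altW (List.mem_reverse.1 h)
    · exact mem_altW h'
  · refine isFullWrt_of_sublists cs hall hab' h₂ (by omega) (by omega) ?_ (hsub_ab.trans hsub)
      (hsub_ab'.trans hsub) (hsub_bb'.trans hsub)
    rw [List.append_cons]
    refine isReduced_append cs hω (isReduced_of_cons cs hτ) (fun x h h' => hinter x ?_ ?_) hτ
    · rcases List.mem_append.1 h with h | h
      · exact mem_altW (List.mem_reverse.1 h)
      · exact .inr (List.mem_singleton.1 h)
    · exact mem_altW h'

end ProductOfDihedral

/-- in a rank-3 Coxeter system `S = {a, b, b'}` with `m_{ab}, m_{ab'} ≥ 3`,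
the set `G = ⟨a,b'⟩⟨a,b⟩` contains no full element if `m_{bb'} > 2` or one of `m_{ab}`,
`m_{ab'}` is infinite; and if `m_{bb'} = 2` and `m_{ab}, m_{ab'} < ∞`, its full elements
are exactly `Γ = ⟨m_{ab'}-1,a,b'][b,a,m_{ab}-1⟩` and
`Γ' = ⟨m_{ab'}-1,a,b'] a [b,a,m_{ab}-1⟩`. -/
theorem stmt16 {B : Type*} {W : Type*} [Group W] {M : CoxeterMatrix B}
    (cs : CoxeterSystem M W) (a b b' : B)
    (hab : a ≠ b) (hab' : a ≠ b') (hbb' : b ≠ b')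
    (hall : ∀ i : B, i = a ∨ i = b ∨ i = b')
    (hMab : M a b = 0 ∨ 3 ≤ M a b) (hMab' : M a b' = 0 ∨ 3 ≤ M a b') :
    ((M b b' = 0 ∨ 2 < M b b' ∨ M a b = 0 ∨ M a b' = 0) →
      ∀ w : W, (∃ u ∈ dihedral cs a b', ∃ v ∈ dihedral cs a b, w = u * v) →
        ¬ IsFullWrt cs Set.univ w) ∧
    ((M b b' = 2 ∧ M a b ≠ 0 ∧ M a b' ≠ 0) →
      ∀ w : W,
        ((∃ u ∈ dihedral cs a b', ∃ v ∈ dihedral cs a b, w = u * v) ∧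
            IsFullWrt cs Set.univ w) ↔
          (w = cs.wordProd ((altW b' a (M a b' - 1)).reverse ++ altW b a (M a b - 1)) ∨
           w = cs.wordProd
              ((altW b' a (M a b' - 1)).reverse ++ a :: altW b a (M a b - 1)))) := by
  refine ⟨?_, ?_⟩
  · rintro hM w ⟨u, hu, v, hv, rfl⟩
    exact not_isFullWrt_of_mem_dihedral_mul cs hab hab' hbb' hM hu hv
  rintro ⟨hMbb', hM, hM'⟩ w
  constructor
  · rintro ⟨⟨u, hu, v, hv, rfl⟩, hfull⟩
    exact eq_of_isFullWrt_of_mem_dihedral_mul cs hab hab' hbb' hM hM' hu hv hfull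
  · have hfull := isFullWrt_words cs hab hab' hbb' hall hMbb' (hMab.resolve_left hM)
      (hMab'.resolve_left hM')
    have hu : cs.wordProd (altW b' a (M a b' - 1)).reverse ∈ dihedral cs a b' :=
      wordProd_mem_dihedral cs fun x hx => (mem_altW (List.mem_reverse.1 hx)).symm
    rintro (rfl | rfl)
    · refine ⟨⟨_, hu, _, wordProd_mem_dihedral cs fun x hx => (mem_altW hx).symm,
        cs.wordProd_append _ _⟩, hfull.1⟩
    · refine ⟨⟨_, hu, _, wordProd_mem_dihedral cs fun x hx => ?_,
        cs.wordProd_append _ _⟩, hfull.2⟩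
      rcases List.mem_cons.1 hx with hx | hx
      · exact .inl hx
      · exact (mem_altW hx).symm
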